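/- Let G be a group with the property K̄∞, and let A be a torsion-free abelian normal subgroup of G. Then A is contained in the center Z(G) of G. -/

import Mathlib

/-- A group `G` has property K̄∞ if for every subgroup `X` of `G` the set of
subgroups of the form `⁅X, H⁆`, with `H` ranging over infinite subgroups of `G`,
is finite. -/
def PropKInf (G : Type*) [Group G] : Prop :=
  ∀ X : Subgroup G, {S : Subgroup G | ∃ H : Subgroup G, Infinite H ∧ S = ⁅X, H⁆}.Finite

lemma isJacobsonRing_int_aux : IsJacobsonRing ℤ := by
  rw [isJacobsonRing_iff_prime_eq]
  intro P hP
  by_cases h : P = ⊥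
  · subst h
    rw [eq_bot_iff]
    intro x hx
    rw [Ideal.mem_jacobson_bot] at hx
    have := Int.isUnit_iff.mp (hx (3 * x))
    rw [Ideal.mem_bot]
    rcases this with h | h <;> nlinarith [sq_nonneg x]
  · have := hP.isMaximal h
    exact Ideal.jacobson_eq_self_of_isMaximal

lemma alg_aux {S V : Type*} [CommRing S] [Algebra.FiniteType ℤ S] [AddCommGroup V] [Module S V]
    (b : V) (hdiv : ∀ n : ℕ, 0 < n → ∃ s : S, (n : S) • s • b = b) : b = 0 := by
  by_contra hb
  have hI : LinearMap.ker (LinearMap.toSpanSingleton S V b) ≠ (⊤ : Ideal S) := by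
    intro h
    have : (1 : S) ∈ LinearMap.ker (LinearMap.toSpanSingleton S V b) := by
      rw [h]; trivial
    simp at this
    exact hb this
  obtain ⟨J, hJ, hIJ⟩ := Ideal.exists_le_maximal _ hI
  let : Field (S ⧸ J) := Ideal.Quotient.field J
  have : Algebra.FiniteType ℤ (S ⧸ J) :=
    Algebra.FiniteType.of_surjective (Ideal.Quotient.mkₐ ℤ J) (Ideal.Quotient.mkₐ_surjective ℤ J)
  have := isJacobsonRing_int_aux
  have hfin : Module.Finite ℤ (S ⧸ J) := finite_of_finite_type_of_isJacobsonRing ℤ (S ⧸ J)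
  have hn : ∀ n : ℕ, (n : S ⧸ J) = 0 → n = 0 := by
    intro n h0
    by_contra hne
    obtain ⟨s, hs⟩ := hdiv n (Nat.pos_of_ne_zero hne)
    have h1 : (n : S) * s - 1 ∈ J := by
      apply hIJ
      simp [sub_smul, mul_smul, hs]
    have h2 := Ideal.Quotient.eq_zero_iff_mem.mpr h1
    rw [map_sub, map_mul, map_natCast, h0] at h2
    simp at h2
  have : CharZero (S ⧸ J) := charZero_of_inj_zero hn
  have hint : Algebra.IsIntegral ℤ (S ⧸ J) := inferInstance
  exact Int.not_isField (isField_of_isIntegral_of_isField (R := ℤ) (S := S ⧸ J)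
    (by intro x y h; simpa using h) (Field.toIsField _))

lemma alg_main {V : Type*} [AddCommGroup V] (φ ψ : Module.End ℤ V) (h : φ * ψ = ψ * φ) (b : V)
    (hdiv : ∀ n : ℕ, 0 < n → ∃ s ∈ Algebra.adjoin ℤ {φ, ψ}, n • s b = b) : b = 0 := by
  let : CommRing (Algebra.adjoin ℤ {φ, ψ}) := Algebra.adjoinCommRingOfComm ℤ (by
    rintro a (rfl | rfl) c (rfl | rfl) <;> simp [h])
  have : Algebra.FiniteType ℤ (Algebra.adjoin ℤ {φ, ψ}) :=
    (Subalgebra.fg_iff_finiteType _).mp (Subalgebra.fg_def.mpr ⟨{φ, ψ}, by simp, rfl⟩)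
  refine alg_aux (S := Algebra.adjoin ℤ {φ, ψ}) b ?_
  intro n hn
  obtain ⟨s, hs, hsb⟩ := hdiv n hn
  refine ⟨⟨s, hs⟩, ?_⟩
  rw [Nat.cast_smul_eq_nsmul]
  exact hsb

open scoped commutatorElement

theorem stmt_2 (G : Type*) [Group G] (hG : PropKInf G) (A : Subgroup G)
    (hnorm : A.Normal) (hab : ∀ x y : A, x * y = y * x)
    (htf : ∀ a ∈ A, a ≠ 1 → ¬IsOfFinOrder a) :
    A ≤ Subgroup.center G := by
  intro a ha
  rw [Subgroup.mem_center_iff]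
  intro g
  by_cases ha1 : a = 1
  · simp [ha1]
  let : CommGroup A := { (inferInstance : Group A) with mul_comm := hab }
  let F (g : G) : Module.End ℤ (Additive A) :=
    (MonoidHom.toAdditive ((MulAut.conjNormal g : MulAut A) : A →* A)).toIntLinearMap
  have hF : ∀ (g : G) (c : Additive A), (((F g c).toMul : A) : G) = g * (c.toMul : A) * g⁻¹ := by
    intro g c; exact MulAut.conjNormal_apply g c.toMul
  have ext' : ∀ c d : Additive A, ((c.toMul : A) : G) = (d.toMul : A) → c = d := by
    intro c d h; exact Additive.toMul.injective (Subtype.ext h)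
  have hFF : ∀ g c, F g (F g⁻¹ c) = c := by
    intro g c; apply ext'; rw [hF, hF]; group
  have hFF' : ∀ g c, F g⁻¹ (F g c) = c := by
    intro g c; apply ext'; rw [hF, hF]; group
  have hcomm : F g * F g⁻¹ = F g⁻¹ * F g := by
    ext c : 1
    change F g (F g⁻¹ c) = F g⁻¹ (F g c)
    rw [hFF, hFF']
  set S := Algebra.adjoin ℤ {F g, F g⁻¹} with hS
  have hφS : F g ∈ S := Algebra.subset_adjoin (by simp)
  have hψS : F g⁻¹ ∈ S := Algebra.subset_adjoin (by simp)
  have key : ∀ i : ℤ, ∃ s ∈ S, ∀ c : Additive A, s (F g c - c) = F (g ^ i) c - c := by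
    intro i
    induction i using Int.induction_on with
    | zero =>
      refine ⟨0, S.zero_mem, fun c => ?_⟩
      have : F (g ^ (0:ℤ)) c = c := by apply ext'; rw [hF]; simp
      rw [this]; simp
    | succ i ih =>
      obtain ⟨s, hs, h⟩ := ih
      refine ⟨F g * s + 1, S.add_mem (S.mul_mem hφS hs) S.one_mem, fun c => ?_⟩
      have : F (g ^ ((i:ℤ) + 1)) c = F g (F (g ^ (i:ℤ)) c) := by
        apply ext'; rw [hF, hF, hF]; group
      rw [this, LinearMap.add_apply, Module.End.mul_apply, h, map_sub]; simp
    | pred i ih =>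
      obtain ⟨s, hs, h⟩ := ih
      refine ⟨F g⁻¹ * (s - 1), S.mul_mem hψS (S.sub_mem hs S.one_mem), fun c => ?_⟩
      have : F (g ^ (-(i:ℤ) - 1)) c = F g⁻¹ (F (g ^ (-(i:ℤ))) c) := by
        apply ext'; rw [hF, hF, hF]; group
      rw [this, Module.End.mul_apply, LinearMap.sub_apply, h, Module.End.one_apply, map_sub,
        map_sub, map_sub, hFF']; abel
  let a' : Additive A := Additive.ofMul ⟨a, ha⟩
  let b : Additive A := F g a' - a'
  have hcom : ∀ (x : G) (c : Additive A), ((F x c - c).toMul : G) = ⁅x, ((c.toMul : A) : G)⁆ := by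
    intro x c
    rw [toMul_sub, Subgroup.coe_div, hF, commutatorElement_def, div_eq_mul_inv]
  let N (n : ℕ) : Subgroup G :=
    { carrier := {x | ∃ s ∈ S, x = ((s (n • b)).toMul : A)}
      one_mem' := ⟨0, S.zero_mem, by simp⟩
      mul_mem' := by
        rintro x y ⟨s, hs, rfl⟩ ⟨t, ht, rfl⟩
        exact ⟨s + t, S.add_mem hs ht, by simp⟩
      inv_mem' := by
        rintro x ⟨s, hs, rfl⟩
        exact ⟨-s, S.neg_mem hs, by simp⟩ }
  have hle : ∀ n : ℕ, ⁅Subgroup.zpowers g, Subgroup.zpowers (a ^ n)⁆ ≤ N n := by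
    intro n
    rw [Subgroup.commutator_le]
    rintro x ⟨i, rfl⟩ y ⟨j, rfl⟩
    obtain ⟨s, hs, h⟩ := key i
    refine ⟨j • s, S.zsmul_mem hs j, ?_⟩
    have h1 := h (j • n • a')
    have h2 : F g (j • n • a') - j • n • a' = j • n • b := by
      simp only [b, map_zsmul, map_nsmul, smul_sub]
    rw [h2] at h1
    rw [LinearMap.smul_apply, ← map_zsmul, h1, hcom]
    simp [a']
  have hmem : ∀ n : ℕ, (((n • b).toMul : A) : G) ∈
      ⁅Subgroup.zpowers g, Subgroup.zpowers (a ^ n)⁆ := by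
    intro n
    have h2 : n • b = F g (n • a') - n • a' := by
      simp only [b, map_nsmul, smul_sub]
    rw [h2, hcom]
    exact Subgroup.commutator_mem_commutator (Subgroup.mem_zpowers g)
      (by simp [a'])
  have htf' : ∀ (n : ℕ) (c : Additive A), 0 < n → n • c = 0 → c = 0 := by
    intro n c hn h
    by_contra hc
    refine htf (c.toMul : A) (c.toMul).2 ?_ ?_
    · intro h1; exact hc (ext' _ _ (by simpa using h1))
    · refine isOfFinOrder_iff_pow_eq_one.mpr ⟨n, hn, ?_⟩
      have := congrArg (fun c : Additive A => ((c.toMul : A) : G)) h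
      simpa using this
  have hb : b = 0 := by
    refine alg_main (F g) (F g⁻¹) hcomm b ?_
    intro n hn
    have hfin := hG (Subgroup.zpowers g)
    let f : ℕ → Subgroup G := fun i => ⁅Subgroup.zpowers g, Subgroup.zpowers (a ^ (n ^ i))⁆
    have hf : ∀ i, f i ∈ {S : Subgroup G | ∃ H : Subgroup G, Infinite H ∧
        S = ⁅Subgroup.zpowers g, H⁆} := by
      intro i
      refine ⟨_, ?_, rfl⟩
      apply Set.infinite_coe_iff.mpr
      rw [infinite_zpowers]
      rw [isOfFinOrder_pow]
      have := htf a ha ha1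
      have : n ^ i ≠ 0 := (pow_pos hn i).ne'
      tauto
    obtain ⟨i, -, j, -, hij, hEq⟩ :=
      Set.infinite_univ.exists_lt_map_eq_of_mapsTo (fun i _ => hf i) hfin
    have h0 : _ ∈ f i := hmem (n ^ i)
    rw [hEq] at h0
    have h1 := hle _ h0
    obtain ⟨s, hs, h⟩ := h1
    have h3 : n ^ i • b = s (n ^ j • b) := ext' _ _ h
    obtain ⟨k, rfl⟩ := Nat.exists_eq_add_of_lt hij
    refine ⟨n ^ k • s, S.nsmul_mem hs _, ?_⟩
    symm
    rw [← sub_eq_zero]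
    apply htf' (n ^ i) _ (pow_pos hn i)
    rw [smul_sub, h3, map_nsmul, LinearMap.smul_apply, ← mul_smul, ← mul_smul, sub_eq_zero]
    congr 1
    ring
  have := hcom g a'
  change ((b.toMul : A) : G) = ⁅g, a⁆ at this
  rw [hb] at this
  exact (commutatorElement_eq_one_iff_mul_comm.mp (this.symm.trans (by simp)))
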